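/- arXiv:2205.01658 — 2 statements merged into one kernel-verified Lean document; each statement's English description precedes it below -/
import Mathlib

section
/- Let S = k[x₁, …, xₙ] be a polynomial ring over a field k, let I ⊆ (x₁,…,xₙ) be a homogeneous ideal, and let I₂ be the ideal of S generated by the homogeneous elements of I of degree two. Then cs(S/I) = cs(S/I₂) and ms(S/I) = ms(S/I₂). -/
/-- The minimal number of generators of an ideal. -/
noncomputable def mu {R : Type*} [CommRing R] (I : Ideal R) : ℕ :=
  sInf {m : ℕ | ∃ s : Finset R, s.card = m ∧ Ideal.span (s : Set R) = I}

/-- An ideal of a polynomial ring is homogeneous if it is generated by a set of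
homogeneous polynomials. -/
def IsHomogeneousIdeal {k : Type*} [Field k] {n : ℕ}
    (I : Ideal (MvPolynomial (Fin n) k)) : Prop :=
  ∃ T : Set (MvPolynomial (Fin n) k),
    (∀ p ∈ T, ∃ d : ℕ, MvPolynomial.IsHomogeneous p d) ∧ Ideal.span T = I

/-- The image `m̄` of the irrelevant maximal ideal `m = (x₁, …, xₙ)` in the quotient
`k[x₁, …, xₙ]/I`. -/
noncomputable def mbar {k : Type*} [Field k] {n : ℕ}
    (I : Ideal (MvPolynomial (Fin n) k)) : Ideal (MvPolynomial (Fin n) k ⧸ I) :=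
  Ideal.map (Ideal.Quotient.mk I)
    (Ideal.span (Set.range (MvPolynomial.X : Fin n → MvPolynomial (Fin n) k)))

/-- An ideal of the quotient `k[x₁, …, xₙ]/I` is homogeneous if it is generated by the
images of a set of homogeneous polynomials. -/
def IsHomogeneousQuotIdeal {k : Type*} [Field k] {n : ℕ}
    (I : Ideal (MvPolynomial (Fin n) k))
    (J : Ideal (MvPolynomial (Fin n) k ⧸ I)) : Prop :=
  ∃ T : Set (MvPolynomial (Fin n) k),
    (∀ p ∈ T, ∃ d : ℕ, MvPolynomial.IsHomogeneous p d) ∧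
    J = Ideal.map (Ideal.Quotient.mk I) (Ideal.span T)

/-- `cs` of the standard graded algebra `k[x₁, …, xₙ]/I`:
the minimum of `μ(J)` over the homogeneous ideals `J ⊆ m̄` with `J² = m̄²`. -/
noncomputable def csGr {k : Type*} [Field k] {n : ℕ}
    (I : Ideal (MvPolynomial (Fin n) k)) : ℕ :=
  sInf {m : ℕ | ∃ J : Ideal (MvPolynomial (Fin n) k ⧸ I),
    IsHomogeneousQuotIdeal I J ∧ J ≤ mbar I ∧ J ^ 2 = (mbar I) ^ 2 ∧ mu J = m}

/-- `ms` of the standard graded algebra `k[x₁, …, xₙ]/I`: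
the minimum of `μ(J)` over the homogeneous ideals `J ⊆ m̄` with `m̄² ⊆ J`. -/
noncomputable def msGr {k : Type*} [Field k] {n : ℕ}
    (I : Ideal (MvPolynomial (Fin n) k)) : ℕ :=
  sInf {m : ℕ | ∃ J : Ideal (MvPolynomial (Fin n) k ⧸ I),
    IsHomogeneousQuotIdeal I J ∧ J ≤ mbar I ∧ (mbar I) ^ 2 ≤ J ∧ mu J = m}

section Helpers

open MvPolynomial
open scoped Pointwise

lemma aux_map_le {R : Type*} [CommRing R] (I A B : Ideal R) :
    Ideal.map (Ideal.Quotient.mk I) A ≤ Ideal.map (Ideal.Quotient.mk I) B ↔ A ≤ B ⊔ I := by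
  rw [Ideal.map_le_iff_le_comap,
    Ideal.comap_map_of_surjective _ Ideal.Quotient.mk_surjective, ← RingHom.ker_eq_comap_bot,
    Ideal.mk_ker]

lemma aux_mu_le {R : Type*} [CommRing R] (J : Ideal R) (s : Finset R)
    (h : Ideal.span (s : Set R) = J) : mu J ≤ s.card :=
  Nat.sInf_le ⟨s, rfl, h⟩

lemma aux_mu_map_le {R : Type*} [CommRing R] (I A : Ideal R) (s : Finset R)
    (h : Ideal.map (Ideal.Quotient.mk I) (Ideal.span (s : Set R)) =
      Ideal.map (Ideal.Quotient.mk I) A) :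
    mu (Ideal.map (Ideal.Quotient.mk I) A) ≤ s.card := by
  classical
  refine (aux_mu_le _ (s.image (Ideal.Quotient.mk I)) ?_).trans Finset.card_image_le
  rw [← h, Ideal.map_span, Finset.coe_image]

lemma aux_exists_gen {R : Type*} [CommRing R] [IsNoetherianRing R] (I A : Ideal R) :
    ∃ s : Finset R, s.card ≤ mu (Ideal.map (Ideal.Quotient.mk I) A) ∧
      Ideal.map (Ideal.Quotient.mk I) (Ideal.span (s : Set R)) =
      Ideal.map (Ideal.Quotient.mk I) A := by
  classical
  have hne : {m : ℕ | ∃ s : Finset (R ⧸ I), s.card = m ∧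
      Ideal.span (s : Set (R ⧸ I)) = Ideal.map (Ideal.Quotient.mk I) A}.Nonempty := by
    obtain ⟨s, hs⟩ := (isNoetherianRing_iff_ideal_fg (R ⧸ I)).1 inferInstance
      (Ideal.map (Ideal.Quotient.mk I) A)
    exact ⟨s.card, s, rfl, hs⟩
  obtain ⟨s, hs, hs2⟩ := Nat.sInf_mem hne
  refine ⟨s.image (Function.surjInv (Ideal.Quotient.mk_surjective (I := I))),
    Finset.card_image_le.trans hs.le, ?_⟩
  rw [← hs2, Ideal.map_span, Finset.coe_image, ← Set.image_comp]
  congr 1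
  rw [(Function.rightInverse_surjInv _).comp_eq_id, Set.image_id]

/-- Linear algebra: extract few spanning vectors. -/
lemma aux_extract {k V W : Type*} [Field k] [AddCommGroup V] [Module k V]
    [AddCommGroup W] [Module k W] (f : V →ₗ[k] W) (T : Set V) (B : Finset W)
    (h : ∀ t ∈ T, f t ∈ Submodule.span k (B : Set W)) :
    ∃ T' : Finset V, (T' : Set V) ⊆ T ∧ T'.card ≤ B.card ∧
      ∀ t ∈ T, f t ∈ Submodule.span k (f '' (T' : Set V)) := by
  classical
  obtain ⟨b, hbT, hbs, hli⟩ := exists_linearIndependent k (f '' T)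
  have hle : Submodule.span k b ≤ Submodule.span k (B : Set W) := by
    rw [hbs, Submodule.span_le]
    rintro _ ⟨t, ht, rfl⟩
    exact h t ht
  have : FiniteDimensional k (Submodule.span k b) := Submodule.finiteDimensional_of_le hle
  have hfin : b.Finite := by
    have h1 := linearIndependent_span hli
    have h3 : IsNoetherian k (Submodule.span k (Set.range (Subtype.val : b → W))) := by
      rw [Subtype.range_coe]; infer_instance
    have h2 := h1.finite_of_isNoetherian
    exact Set.toFinite b
  lift b to Finset W using hfin
  have hcard : b.card ≤ B.card := by
    rw [← finrank_span_finset_eq_card (R := k) (s := b) hli]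
    exact (Submodule.finrank_mono hle).trans (finrank_span_finset_le_card B)
  choose! g hg hfg using hbT
  refine ⟨b.image g, ?_, Finset.card_image_le.trans hcard, ?_⟩
  · intro x hx
    simp only [Finset.coe_image, Set.mem_image] at hx
    obtain ⟨y, hy, rfl⟩ := hx
    exact hg hy
  · intro t ht
    have h2 : f '' ((b.image g : Finset V) : Set V) = b := by
      rw [Finset.coe_image, ← Set.image_comp]
      ext y
      constructor
      · rintro ⟨z, hz, rfl⟩
        simpa [hfg hz] using hz
      · intro hy
        exact ⟨y, hy, hfg hy⟩
    rw [h2, hbs]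
    exact Submodule.subset_span ⟨t, ht, rfl⟩

variable {k : Type*} [Field k] {n : ℕ}

lemma aux_const (A : Set (MvPolynomial (Fin n) k)) (K : Ideal (MvPolynomial (Fin n) k))
    (h : idealOfVars (Fin n) k * Ideal.span A ≤ K) (x : MvPolynomial (Fin n) k)
    (hx : x ∈ Ideal.span A) :
    x ∈ Submodule.span k A ⊔ K.restrictScalars k := by
  induction hx using Submodule.span_induction with
  | mem x hx => exact Submodule.mem_sup_left (Submodule.subset_span hx)
  | zero => exact zero_mem _
  | add x y _ _ hx hy => exact add_mem hx hy
  | smul r x hx ih =>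
    have hr : r - C (constantCoeff r) ∈ idealOfVars (Fin n) k := by
      rw [← pow_one (idealOfVars (Fin n) k), mem_pow_idealOfVars_iff']
      intro d hd
      have : d = 0 := by
        rw [← Finsupp.degree_eq_zero_iff]; omega
      subst this
      simp [constantCoeff_eq]
    have : r • x = constantCoeff r • x + (r - C (constantCoeff r)) * x := by
      rw [smul_eq_C_mul, smul_eq_mul]; ring
    rw [this]
    refine add_mem (Submodule.smul_mem _ _ ih) (Submodule.mem_sup_right ?_)
    exact h (Ideal.mul_mem_mul hr hx)

lemma aux_hom_comp (T : Set (MvPolynomial (Fin n) k))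
    (hT : ∀ p ∈ T, ∃ d : ℕ, MvPolynomial.IsHomogeneous p d)
    (p : MvPolynomial (Fin n) k) (hp : p ∈ Ideal.span T) (i : ℕ) :
    homogeneousComponent i p ∈ Ideal.span T := by
  let _ := MvPolynomial.gradedAlgebra (σ := Fin n) (R := k)
  have := Ideal.homogeneous_span (homogeneousSubmodule (Fin n) k) T
    (fun x hx => by
      obtain ⟨d, hd⟩ := hT x hx
      exact ⟨d, hd⟩)
  have h2 := this i hp
  rw [← decomposition.decompose'_apply]
  exact h2

lemma aux_deg2 (I : Ideal (MvPolynomial (Fin n) k)) (hI : IsHomogeneousIdeal I)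
    (T : Set (MvPolynomial (Fin n) k))
    (hT : ∀ p ∈ T, ∃ d : ℕ, MvPolynomial.IsHomogeneous p d)
    (h : idealOfVars (Fin n) k ^ 2 ≤ Ideal.span T ⊔ idealOfVars (Fin n) k ^ 3 ⊔ I) :
    idealOfVars (Fin n) k ^ 2 ≤ Ideal.span T ⊔ Ideal.span
        {p : MvPolynomial (Fin n) k | p ∈ I ∧ MvPolynomial.IsHomogeneous p 2} := by
  obtain ⟨U, hU, rfl⟩ := hI
  have key : ∀ p ∈ idealOfVars (Fin n) k ^ 2, p.IsHomogeneous 2 →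
      p ∈ Ideal.span T ⊔ Ideal.span
        {p : MvPolynomial (Fin n) k | p ∈ Ideal.span U ∧ MvPolynomial.IsHomogeneous p 2} := by
    intro p hp hp2
    obtain ⟨ab, hab, c, hc, hac⟩ := Submodule.mem_sup.1 (h hp)
    obtain ⟨a, ha, b, hb, rfl⟩ := Submodule.mem_sup.1 hab
    have hb0 : homogeneousComponent 2 b = 0 := by
      rw [mem_pow_idealOfVars_iff'] at hb
      ext d
      rw [coeff_homogeneousComponent]
      split_ifs with hd
      · rw [hb d (by omega)]; simp
      · simp
    have h3 : p = homogeneousComponent 2 a + homogeneousComponent 2 c := by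
      have h4 := homogeneousComponent_of_mem (m := 2) ((mem_homogeneousSubmodule 2 p).2 hp2)
      rw [if_pos rfl, ← hac, map_add, map_add, hb0, add_zero] at h4
      rw [← hac, h4]
    rw [h3]
    refine add_mem (Submodule.mem_sup_left (aux_hom_comp T hT a ha 2))
      (Submodule.mem_sup_right (Ideal.subset_span ⟨aux_hom_comp U hU c hc 2,
        homogeneousComponent_isHomogeneous _ _⟩))
  have h5 : idealOfVars (Fin n) k ^ 2 = Ideal.span
      (Set.range (X : Fin n → MvPolynomial (Fin n) k) *
        Set.range (X : Fin n → MvPolynomial (Fin n) k)) := by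
    rw [pow_two, idealOfVars, Ideal.span_mul_span']
  conv_lhs => rw [h5]
  rw [Ideal.span_le]
  intro q hq
  refine key q (h5 ▸ Ideal.subset_span hq) ?_
  obtain ⟨_, ⟨i, rfl⟩, _, ⟨j, rfl⟩, rfl⟩ := Set.mem_mul.1 hq
  exact (isHomogeneous_X k i).mul (isHomogeneous_X k j)

/-- Approximate homogeneous generators. -/
lemma aux_gens (I : Ideal (MvPolynomial (Fin n) k)) (T : Set (MvPolynomial (Fin n) k))
    (hTm : Ideal.span T ≤ idealOfVars (Fin n) k) :
    ∃ T' : Finset (MvPolynomial (Fin n) k), (T' : Set (MvPolynomial (Fin n) k)) ⊆ T ∧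
      T'.card ≤ mu (Ideal.map (Ideal.Quotient.mk I) (Ideal.span T)) ∧
      Ideal.span T ≤ Ideal.span (T' : Set (MvPolynomial (Fin n) k)) ⊔
        idealOfVars (Fin n) k ^ 3 ⊔ I := by
  classical
  obtain ⟨s, hs, hsT⟩ := aux_exists_gen I (Ideal.span T)
  set m := idealOfVars (Fin n) k with hm
  set K : Ideal (MvPolynomial (Fin n) k) := m * Ideal.span T ⊔ I with hK
  have hsT1 : Ideal.span (s : Set (MvPolynomial (Fin n) k)) ≤ Ideal.span T ⊔ I :=
    (aux_map_le _ _ _).1 hsT.le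
  have hsT2 : Ideal.span T ≤ Ideal.span (s : Set (MvPolynomial (Fin n) k)) ⊔ I :=
    (aux_map_le _ _ _).1 hsT.ge
  have hsK : m * Ideal.span (s : Set (MvPolynomial (Fin n) k)) ≤ K := by
    refine (Ideal.mul_mono_right hsT1).trans ?_
    rw [Ideal.mul_sup]
    exact sup_le_sup_left Ideal.mul_le_right _
  let f := (K.restrictScalars k).mkQ
  have hfK : ∀ x ∈ K, f x = 0 := fun x hx => (Submodule.Quotient.mk_eq_zero _).2 hx
  obtain ⟨T', hT', hcard, hspan⟩ := aux_extract f T (s.image f) (by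
    intro t ht
    obtain ⟨a, ha, b, hb, rfl⟩ := Submodule.mem_sup.1 (hsT2 (Ideal.subset_span ht))
    obtain ⟨c, hc, d, hd, rfl⟩ := Submodule.mem_sup.1 (aux_const _ K hsK a ha)
    rw [map_add, map_add, hfK d hd, hfK b (Submodule.mem_sup_right hb), add_zero, add_zero,
      Finset.coe_image, ← Submodule.map_span]
    exact Submodule.mem_map_of_mem hc)
  refine ⟨T', hT', hcard.trans (Finset.card_image_le.trans hs), ?_⟩
  set H := Ideal.span (T' : Set (MvPolynomial (Fin n) k)) with hH
  have h1 : Ideal.span T ≤ H ⊔ K := by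
    rw [Ideal.span_le]
    intro t ht
    have h2 := hspan t ht
    rw [← Submodule.map_span] at h2
    obtain ⟨u, hu, hut⟩ := h2
    have h3 : t - u ∈ K := by
      have := (Submodule.Quotient.eq (K.restrictScalars k)).1 hut.symm
      exact this
    have h4 : u ∈ H := Submodule.span_le_restrictScalars k _ _ hu
    have : t = u + (t - u) := by ring
    rw [this]
    exact Submodule.add_mem_sup h4 h3
  have step : ∀ j : ℕ, Ideal.span T ≤ H ⊔ m ^ j ⊔ I → Ideal.span T ≤ H ⊔ m ^ (j + 1) ⊔ I := by
    intro j hj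
    refine h1.trans (sup_le (le_sup_left.trans le_sup_left) (sup_le ?_ le_sup_right))
    refine (Ideal.mul_mono_right hj).trans ?_
    rw [Ideal.mul_sup, Ideal.mul_sup, ← pow_succ']
    exact sup_le_sup (sup_le_sup_right Ideal.mul_le_right _) Ideal.mul_le_right
  apply step
  apply step
  rw [pow_one]
  exact hTm.trans (le_sup_right.trans le_sup_left)

lemma aux_mbar (I : Ideal (MvPolynomial (Fin n) k)) :
    mbar I = Ideal.map (Ideal.Quotient.mk I) (idealOfVars (Fin n) k) := rfl

lemma aux_mbar_hom (I : Ideal (MvPolynomial (Fin n) k)) :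
    IsHomogeneousQuotIdeal I (mbar I) :=
  ⟨_, by rintro _ ⟨i, rfl⟩; exact ⟨1, isHomogeneous_X k i⟩, rfl⟩

lemma aux_cs_nonempty (I : Ideal (MvPolynomial (Fin n) k)) :
    {m : ℕ | ∃ J : Ideal (MvPolynomial (Fin n) k ⧸ I),
    IsHomogeneousQuotIdeal I J ∧ J ≤ mbar I ∧ J ^ 2 = (mbar I) ^ 2 ∧ mu J = m}.Nonempty :=
  ⟨_, mbar I, aux_mbar_hom I, le_rfl, rfl, rfl⟩

lemma aux_ms_nonempty (I : Ideal (MvPolynomial (Fin n) k)) :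
    {m : ℕ | ∃ J : Ideal (MvPolynomial (Fin n) k ⧸ I),
    IsHomogeneousQuotIdeal I J ∧ J ≤ mbar I ∧ (mbar I) ^ 2 ≤ J ∧ mu J = m}.Nonempty :=
  ⟨_, mbar I, aux_mbar_hom I, le_rfl, Ideal.pow_le_self (n := 2) (by decide), rfl⟩

/-- Passing to a bigger ideal does not increase `mu`. -/
lemma aux_mu_mono (I I' A : Ideal (MvPolynomial (Fin n) k)) (h : I' ≤ I) :
    mu (Ideal.map (Ideal.Quotient.mk I) A) ≤ mu (Ideal.map (Ideal.Quotient.mk I') A) := by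
  obtain ⟨s, hs, hsA⟩ := aux_exists_gen I' A
  refine (aux_mu_map_le I A s (le_antisymm ?_ ?_)).trans hs
  · exact (aux_map_le _ _ _).2 (((aux_map_le _ _ _).1 hsA.le).trans (sup_le_sup_left h _))
  · exact (aux_map_le _ _ _).2 (((aux_map_le _ _ _).1 hsA.ge).trans (sup_le_sup_left h _))

lemma aux_sq {a b : Ideal (MvPolynomial (Fin n) k)} (I : Ideal (MvPolynomial (Fin n) k))
    (h : a ≤ b ⊔ idealOfVars (Fin n) k ^ 3 ⊔ I) :
    a ^ 2 ≤ b * b ⊔ idealOfVars (Fin n) k ^ 3 ⊔ I := by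
  rw [pow_two]
  refine (Ideal.mul_mono h h).trans ?_
  rw [Ideal.mul_sup]
  refine sup_le ?_ (Ideal.mul_le_right.trans le_sup_right)
  rw [Ideal.sup_mul]
  refine sup_le ?_ (Ideal.mul_le_left.trans le_sup_right)
  refine le_trans ?_ le_sup_left
  rw [Ideal.mul_sup]
  refine sup_le ?_ (Ideal.mul_le_right.trans le_sup_right)
  rw [Ideal.sup_mul]
  exact sup_le_sup_left Ideal.mul_le_left _

lemma aux_deg2_sq (I : Ideal (MvPolynomial (Fin n) k)) (hI : IsHomogeneousIdeal I)
    (T : Set (MvPolynomial (Fin n) k))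
    (hT : ∀ p ∈ T, ∃ d : ℕ, MvPolynomial.IsHomogeneous p d)
    (h : idealOfVars (Fin n) k ^ 2 ≤
      Ideal.span T * Ideal.span T ⊔ idealOfVars (Fin n) k ^ 3 ⊔ I) :
    idealOfVars (Fin n) k ^ 2 ≤ Ideal.span T ^ 2 ⊔ Ideal.span
        {p : MvPolynomial (Fin n) k | p ∈ I ∧ MvPolynomial.IsHomogeneous p 2} := by
  rw [pow_two (Ideal.span T)]
  rw [Ideal.span_mul_span'] at h ⊢
  refine aux_deg2 I hI _ ?_ h
  intro p hp
  obtain ⟨a, ha, b, hb, rfl⟩ := Set.mem_mul.1 hp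
  obtain ⟨d, hd⟩ := hT a ha
  obtain ⟨e, he⟩ := hT b hb
  exact ⟨d + e, hd.mul he⟩

end Helpers

/-- Let `S = k[x₁, …, xₙ]`, let `I ⊆ (x₁, …, xₙ)` be a homogeneous ideal, and let
`I₂` be the ideal generated by the homogeneous elements of `I` of degree two.  Then
`cs(S/I) = cs(S/I₂)` and `ms(S/I) = ms(S/I₂)`. -/
theorem stmt14 {k : Type*} [Field k] (n : ℕ) (I : Ideal (MvPolynomial (Fin n) k))
    (hIhom : IsHomogeneousIdeal I)
    (hIm : I ≤ Ideal.span (Set.range (MvPolynomial.X : Fin n → MvPolynomial (Fin n) k))) :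
    csGr I = csGr (Ideal.span
        {p : MvPolynomial (Fin n) k | p ∈ I ∧ MvPolynomial.IsHomogeneous p 2}) ∧
    msGr I = msGr (Ideal.span
        {p : MvPolynomial (Fin n) k | p ∈ I ∧ MvPolynomial.IsHomogeneous p 2}) := by
  have hI2 : Ideal.span
        {p : MvPolynomial (Fin n) k | p ∈ I ∧ MvPolynomial.IsHomogeneous p 2} ≤ I :=
    Ideal.span_le.2 fun p hp => hp.1
  have hgen : ∀ T : Set (MvPolynomial (Fin n) k),
      Ideal.map (Ideal.Quotient.mk I) (Ideal.span T) ≤ mbar I →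
      Ideal.span T ≤ MvPolynomial.idealOfVars (Fin n) k := by
    intro T hT
    rw [aux_mbar, aux_map_le] at hT
    exact hT.trans (sup_le le_rfl hIm)
  constructor
  · apply le_antisymm
    · obtain ⟨J, ⟨T, hT, rfl⟩, hJm, hJ2, hmu⟩ := Nat.sInf_mem (aux_cs_nonempty (Ideal.span
        {p : MvPolynomial (Fin n) k | p ∈ I ∧ MvPolynomial.IsHomogeneous p 2}))
      unfold csGr
      rw [← hmu]
      refine le_trans (Nat.sInf_le ⟨_, ⟨T, hT, rfl⟩, ?_, ?_, rfl⟩) (aux_mu_mono I _ _ hI2)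
      · rw [aux_mbar, aux_map_le] at hJm ⊢
        exact hJm.trans (sup_le_sup_left hI2 _)
      · rw [aux_mbar, ← Ideal.map_pow, ← Ideal.map_pow] at hJ2 ⊢
        apply le_antisymm
        · exact (aux_map_le _ _ _).2
            (((aux_map_le _ _ _).1 hJ2.le).trans (sup_le_sup_left hI2 _))
        · exact (aux_map_le _ _ _).2
            (((aux_map_le _ _ _).1 hJ2.ge).trans (sup_le_sup_left hI2 _))
    · obtain ⟨J, ⟨T, hT, rfl⟩, hJm, hJ2, hmu⟩ := Nat.sInf_mem (aux_cs_nonempty I)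
      unfold csGr
      rw [← hmu]
      have hTm := hgen T hJm
      obtain ⟨T', hT', hcard, hle⟩ := aux_gens I T hTm
      have hT'm := (Ideal.span_mono hT').trans hTm
      refine le_trans (Nat.sInf_le ⟨_, ⟨T', fun p hp => hT p (hT' hp), rfl⟩, ?_, ?_, rfl⟩)
        ((aux_mu_map_le _ _ T' rfl).trans hcard)
      · exact Ideal.map_mono hT'm
      · refine le_antisymm (Ideal.pow_right_mono (Ideal.map_mono hT'm) 2) ?_
        rw [aux_mbar, ← Ideal.map_pow, ← Ideal.map_pow] at hJ2 ⊢
        rw [aux_map_le]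
        apply aux_deg2_sq I hIhom _ (fun p hp => hT p (hT' hp))
        exact ((aux_map_le _ _ _).1 hJ2.ge).trans (sup_le (aux_sq I hle) le_sup_right)
  · apply le_antisymm
    · obtain ⟨J, ⟨T, hT, rfl⟩, hJm, hJ2, hmu⟩ := Nat.sInf_mem (aux_ms_nonempty (Ideal.span
        {p : MvPolynomial (Fin n) k | p ∈ I ∧ MvPolynomial.IsHomogeneous p 2}))
      unfold msGr
      rw [← hmu]
      refine le_trans (Nat.sInf_le ⟨_, ⟨T, hT, rfl⟩, ?_, ?_, rfl⟩) (aux_mu_mono I _ _ hI2)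
      · rw [aux_mbar, aux_map_le] at hJm ⊢
        exact hJm.trans (sup_le_sup_left hI2 _)
      · rw [aux_mbar, ← Ideal.map_pow, aux_map_le] at hJ2 ⊢
        exact hJ2.trans (sup_le_sup_left hI2 _)
    · obtain ⟨J, ⟨T, hT, rfl⟩, hJm, hJ2, hmu⟩ := Nat.sInf_mem (aux_ms_nonempty I)
      unfold msGr
      rw [← hmu]
      have hTm := hgen T hJm
      obtain ⟨T', hT', hcard, hle⟩ := aux_gens I T hTm
      have hT'm := (Ideal.span_mono hT').trans hTm
      refine le_trans (Nat.sInf_le ⟨_, ⟨T', fun p hp => hT p (hT' hp), rfl⟩, ?_, ?_, rfl⟩)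
        ((aux_mu_map_le _ _ T' rfl).trans hcard)
      · exact Ideal.map_mono hT'm
      · rw [aux_mbar, ← Ideal.map_pow, aux_map_le] at hJ2 ⊢
        apply aux_deg2 I hIhom _ (fun p hp => hT p (hT' hp))
        exact hJ2.trans (sup_le hle le_sup_right)
end

section
/- Let k be a field, let S = k[x₁, …, xₙ], and let R = S/I where I ⊆ (x₁,…,xₙ)² is a homogeneous ideal minimally generated by t > 0 homogeneous polynomials of degree two. Then (n+1 choose 2) − t ≤ (cs(R)+1 choose 2). Moreover, if t ≤ n − 1, then cs(R) = n = μ(m̄). -/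
open MvPolynomial in
lemma aux_hc {k : Type*} [Field k] {n : ℕ} (G : Set (MvPolynomial (Fin n) k))
    (hG : ∀ g ∈ G, g ∈ (idealOfVars (Fin n) k) ^ 2) (p : MvPolynomial (Fin n) k)
    (hp : p ∈ Ideal.span G) :
    homogeneousComponent 2 p ∈ Submodule.span k (homogeneousComponent 2 '' G) := by
  have hle : Ideal.span G ≤ (idealOfVars (Fin n) k) ^ 2 := Ideal.span_le.2 hG
  induction hp using Submodule.span_induction with
  | mem x h => exact Submodule.subset_span ⟨x, h, rfl⟩
  | zero => simp
  | add x y hx hy ihx ihy => rw [map_add]; exact add_mem ihx ihy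
  | smul a x hx ih =>
    have h1 : a - C (coeff 0 a) ∈ idealOfVars (Fin n) k := by
      rw [← pow_one (idealOfVars (Fin n) k), mem_pow_idealOfVars_iff']
      intro d hd
      have : d = 0 := by
        rw [← Finsupp.degree_eq_zero_iff]; omega
      subst this
      simp
    have h2 : (a - C (coeff 0 a)) * x ∈ (idealOfVars (Fin n) k) ^ 3 := by
      rw [pow_succ' _ 2]; exact Ideal.mul_mem_mul h1 (hle hx)
    have h3 : homogeneousComponent 2 ((a - C (coeff 0 a)) * x) = 0 := by
      rw [mem_pow_idealOfVars_iff'] at h2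
      ext d
      rw [coeff_homogeneousComponent]
      split_ifs with h
      · simpa using h2 d (by omega)
      · simp
    have h4 : a • x = (a - C (coeff 0 a)) * x + C (coeff 0 a) * x := by
      rw [smul_eq_mul]; ring
    rw [h4, map_add, h3, zero_add, homogeneousComponent_C_mul, ← smul_eq_C_mul]
    exact Submodule.smul_mem _ _ ih

open MvPolynomial in
lemma aux_main {k : Type*} [Field k] {n : ℕ}
    (I : Ideal (MvPolynomial (Fin n) k))
    (hIm2 : I ≤ (idealOfVars (Fin n) k) ^ 2)
    (s : Finset (MvPolynomial (Fin n) k)) (hs : Ideal.span (s : Set _) = I)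
    (u : Finset (MvPolynomial (Fin n) k ⧸ I))
    (hu : Ideal.span (u : Set _) ≤ mbar I)
    (hu2 : (Ideal.span (u : Set _)) ^ 2 = mbar I ^ 2) :
    (n + 1).choose 2 ≤ (u.card + 1).choose 2 + s.card := by
  classical
  have hsurj := Ideal.Quotient.mk_surjective (I := I)
  choose f hf using hsurj
  have hIm : I ≤ idealOfVars (Fin n) k := hIm2.trans (Ideal.pow_le_self two_ne_zero)
  have hfm : ∀ a ∈ u, f a ∈ idealOfVars (Fin n) k := by
    intro a ha
    have h1 : a ∈ mbar I := hu (Ideal.subset_span ha)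
    rw [← hf a] at h1
    have h2 : f a ∈ Ideal.comap (Ideal.Quotient.mk I) (mbar I) := h1
    unfold mbar at h2
    rw [Ideal.comap_map_of_surjective' _ Ideal.Quotient.mk_surjective, Ideal.mk_ker] at h2
    exact (sup_le le_rfl hIm) h2
  let g : Sym2 u → MvPolynomial (Fin n) k :=
    Sym2.lift ⟨fun a b => f a * f b, fun a b => mul_comm _ _⟩
  let G : Finset (MvPolynomial (Fin n) k) := Finset.univ.image g ∪ s
  have hG : ∀ p ∈ (G : Set (MvPolynomial (Fin n) k)), p ∈ (idealOfVars (Fin n) k) ^ 2 := by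
    intro p hp
    rcases Finset.mem_union.1 (Finset.mem_coe.1 hp) with h | h
    · obtain ⟨z, -, rfl⟩ := Finset.mem_image.1 h
      induction z using Sym2.ind with
      | _ a b =>
        rw [pow_two]
        exact Ideal.mul_mem_mul (hfm a a.2) (hfm b b.2)
    · exact hIm2 (hs ▸ Ideal.subset_span h)
  have hmem : (idealOfVars (Fin n) k) ^ 2 ≤ Ideal.span (G : Set (MvPolynomial (Fin n) k)) := by
    have h1 : (mbar I) ^ 2 ≤ Ideal.map (Ideal.Quotient.mk I) (Ideal.span (Set.range g)) := by
      rw [← hu2, pow_two, Ideal.span_mul_span', Ideal.span_le]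
      rintro _ ⟨a, ha, b, hb, rfl⟩
      have : (Ideal.Quotient.mk I) (g s(⟨a, ha⟩, ⟨b, hb⟩)) = a * b := by
        simp [g, hf]
      simp only [SetLike.mem_coe]
      rw [← this]
      exact Ideal.mem_map_of_mem _ (Ideal.subset_span ⟨_, rfl⟩)
    unfold mbar at h1
    rw [← Ideal.map_pow, Ideal.map_le_iff_le_comap,
      Ideal.comap_map_of_surjective' _ Ideal.Quotient.mk_surjective, Ideal.mk_ker] at h1
    refine h1.trans (sup_le (Ideal.span_mono ?_) (hs.ge.trans (Ideal.span_mono ?_)))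
    · simp [G]
    · simp [G]
  let v : Sym2 (Fin n) → MvPolynomial (Fin n) k :=
    fun z => monomial (Multiset.toFinsupp z.toMultiset) 1
  have hdeg : ∀ z : Sym2 (Fin n), (Multiset.toFinsupp z.toMultiset).degree = 2 := by
    intro z
    induction z using Sym2.ind with
    | _ a b =>
      have : (s(a, b)).toMultiset = ({a} : Multiset (Fin n)) + {b} := rfl
      rw [this, map_add, map_add, Multiset.toFinsupp_singleton, Multiset.toFinsupp_singleton]
      simp
  have hinj : Function.Injective (fun z : Sym2 (Fin n) => Multiset.toFinsupp z.toMultiset) := by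
    intro z w h
    have h' := Multiset.toFinsupp.injective h
    induction z using Sym2.ind with
    | _ a b =>
      induction w using Sym2.ind with
      | _ c d =>
        exact (Sym2.equivMultiset (Fin n)).injective (Subtype.ext h')
  have hv : LinearIndependent k v :=
    (basisMonomials (Fin n) k).linearIndependent.comp _ hinj
  have hvs : Set.range v ≤ Submodule.span k
      ((G.image (homogeneousComponent 2) : Finset _) : Set (MvPolynomial (Fin n) k)) := by
    rintro _ ⟨z, rfl⟩
    have h1 : v z ∈ (idealOfVars (Fin n) k) ^ 2 :=
      (monomial_mem_pow_idealOfVars_iff 2 _ one_ne_zero).2 (hdeg z).ge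
    have h2 := aux_hc _ hG _ (hmem h1)
    have h3 : homogeneousComponent 2 (v z) = v z :=
      homogeneousComponent_eq_self (isHomogeneous_monomial _ (hdeg z))
    rw [h3] at h2
    simpa using h2
  have := linearIndependent_le_span' v hv _ hvs
  have h5 : Fintype.card (Sym2 (Fin n)) ≤ (G.image (homogeneousComponent 2)).card := by
    simpa using this
  rw [Sym2.card, Fintype.card_fin] at h5
  calc _ ≤ _ := h5
    _ ≤ G.card := Finset.card_image_le
    _ ≤ _ := Finset.card_union_le _ _
    _ ≤ _ := by
      gcongr
      refine Finset.card_image_le.trans ?_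
      rw [Finset.card_univ, Sym2.card, Fintype.card_coe]

lemma mu_spec {R : Type*} [CommRing R] [IsNoetherianRing R] (J : Ideal R) :
    ∃ s : Finset R, s.card = mu J ∧ Ideal.span (s : Set R) = J := by
  refine Nat.sInf_mem (s := {m : ℕ | ∃ s : Finset R, s.card = m ∧ Ideal.span (s : Set R) = J}) ?_
  obtain ⟨s, hs⟩ := (isNoetherianRing_iff_ideal_fg R).1 inferInstance J
  exact ⟨_, s, rfl, hs⟩

/-- Let `S = k[x₁, …, xₙ]` and `R = S/I`, where `I ⊆ (x₁, …, xₙ)²` is a homogeneous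
ideal minimally generated by `t > 0` homogeneous polynomials of degree two.  Then
`(n+1 choose 2) − t ≤ (cs(R)+1 choose 2)`, and moreover if `t ≤ n − 1` then
`cs(R) = n = μ(m̄)`. -/
theorem stmt16 {k : Type*} [Field k] (n t : ℕ) (ht : 0 < t)
    (I : Ideal (MvPolynomial (Fin n) k))
    (hIm2 : I ≤ (Ideal.span
      (Set.range (MvPolynomial.X : Fin n → MvPolynomial (Fin n) k))) ^ 2)
    (hgen : ∃ s : Finset (MvPolynomial (Fin n) k), s.card = t ∧
      (∀ p ∈ s, MvPolynomial.IsHomogeneous p 2) ∧ Ideal.span (s : Set _) = I)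
    (hmin : mu I = t) :
    (((n + 1).choose 2 : ℤ) - t ≤ ((csGr I + 1).choose 2 : ℤ)) ∧
    (t ≤ n - 1 → csGr I = n ∧ n = mu (mbar I)) := by
  classical
  obtain ⟨s, hsc, -, hs⟩ := hgen
  have hmem : mu (mbar I) ∈ {m : ℕ | ∃ J : Ideal (MvPolynomial (Fin n) k ⧸ I),
      IsHomogeneousQuotIdeal I J ∧ J ≤ mbar I ∧ J ^ 2 = (mbar I) ^ 2 ∧ mu J = m} := by
    refine ⟨mbar I, ⟨_, ?_, rfl⟩, le_rfl, rfl, rfl⟩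
    rintro _ ⟨i, rfl⟩
    exact ⟨1, MvPolynomial.isHomogeneous_X _ _⟩
  have hle : csGr I ≤ mu (mbar I) := Nat.sInf_le hmem
  have hmn : mu (mbar I) ≤ n := by
    let w : Finset (MvPolynomial (Fin n) k ⧸ I) :=
      Finset.univ.image fun i : Fin n => Ideal.Quotient.mk I (MvPolynomial.X i)
    have h1 : mu (mbar I) ≤ w.card := by
      refine Nat.sInf_le ⟨w, rfl, ?_⟩
      rw [mbar, Ideal.map_span, ← Set.range_comp]
      simp [w, Function.comp_def]
    refine h1.trans (Finset.card_image_le.trans ?_)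
    simp
  have hkey : (n + 1).choose 2 ≤ (csGr I + 1).choose 2 + t := by
    obtain ⟨J, -, hJ, hJ2, hmu⟩ := Nat.sInf_mem ⟨_, hmem⟩
    obtain ⟨u, huc, hu⟩ := mu_spec J
    have h := aux_main I hIm2 s hs u (hu ▸ hJ) (hu ▸ hJ2)
    rw [huc, hmu, hsc] at h
    exact h
  refine ⟨by
    have : (((n + 1).choose 2 : ℕ) : ℤ) ≤ (((csGr I + 1).choose 2 + t : ℕ) : ℤ) := by
      exact_mod_cast hkey
    push_cast at this
    linarith, fun htn => ?_⟩
  have hn : n ≤ csGr I := by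
    by_contra hlt
    have h1 : (csGr I + 1).choose 2 ≤ n.choose 2 := Nat.choose_le_choose 2 (by omega)
    have h2 : (n + 1).choose 2 = n.choose 1 + n.choose 2 := Nat.choose_succ_succ n 1
    rw [Nat.choose_one_right] at h2
    omega
  omega
end
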